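/- arXiv:1910.12331 — 3 statements merged into one kernel-verified Lean document; each statement's English description precedes it below -/
import Mathlib

section
/- Let A^{(m)} ∈ ℝ^{s_m×R} for m = 1,…,N be factor matrices and let j^{(n)}_{i_1…i_N k r} = −(∏_{m≠n} a^{(m)}_{i_m r}) δ_{i_n k}. Then for every pair n ≠ p in {1,…,N} and all indices k ∈ {1,…,s_n}, l ∈ {1,…,s_p}, and r, z ∈ {1,…,R}, the off-diagonal block of the Gauss-Newton approximate Hessian satisfies Σ_{i_1,…,i_N} j^{(n)}_{i_1…i_N k r} · j^{(p)}_{i_1…i_N l z} = a^{(n)}_{kz} · a^{(p)}_{lr} · Γ^{(n,p)}_{rz}, where Γ^{(n,p)}_{rz} = ∏_{m≠n,p} (Σ_{i=1}^{s_m} a^{(m)}_{ir} a^{(m)}_{iz}). -/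
open Finset

/-- The off-diagonal blocks of the Gauss-Newton approximate Hessian for CP decomposition:
for `n ≠ p`, `∑_{i₁,…,i_N} j^{(n)}_{i…kr} j^{(p)}_{i…lz} = a^{(n)}_{kz} a^{(p)}_{lr} Γ^{(n,p)}_{rz}`
where `Γ^{(n,p)}_{rz} = ∏_{m≠n,p} ∑_i a^{(m)}_{ir} a^{(m)}_{iz}`. -/
theorem stmt_2 {N : ℕ} (s : Fin N → ℕ) (R : ℕ)
    (A : (m : Fin N) → Fin (s m) → Fin R → ℝ)
    (J : (n : Fin N) → ((m : Fin N) → Fin (s m)) → Fin (s n) → Fin R → ℝ)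
    (hJ : ∀ (n : Fin N) (i : (m : Fin N) → Fin (s m)) (k : Fin (s n)) (r : Fin R),
      J n i k r = -(∏ m ∈ univ.erase n, A m (i m) r) * (if i n = k then 1 else 0))
    (n p : Fin N) (hnp : n ≠ p) (k : Fin (s n)) (l : Fin (s p)) (r z : Fin R) :
    ∑ i : (m : Fin N) → Fin (s m), J n i k r * J p i l z =
      A n k z * A p l r *
        ∏ m ∈ (univ.erase n).erase p, ∑ i : Fin (s m), A m i r * A m i z := by
  classical
  have split : ∀ F : Fin N → ℝ,
      ∏ m, F m = F n * (F p * ∏ m ∈ (univ.erase n).erase p, F m) := by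
    intro F
    rw [Finset.mul_prod_erase _ F (by simp [hnp.symm]), Finset.mul_prod_erase _ F (by simp)]
  let f : (m : Fin N) → Fin (s m) → ℝ :=
    Function.update (Function.update (fun m x => A m x r * A m x z) p
      (fun x => A p x r * (if x = l then 1 else 0))) n
      (fun x => A n x z * (if x = k then 1 else 0))
  have fn : f n = fun x => A n x z * (if x = k then 1 else 0) := by simp [f]
  have fp : f p = fun x => A p x r * (if x = l then 1 else 0) := by
    simp [f, Function.update_of_ne hnp.symm]
  have fm : ∀ m ∈ (univ.erase n).erase p, f m = fun x => A m x r * A m x z := by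
    intro m hm
    simp only [mem_erase, mem_univ, and_true] at hm
    simp [f, Function.update_of_ne hm.1, Function.update_of_ne hm.2]
  have key : ∏ m, ∑ x, f m x = ∑ i : (m : Fin N) → Fin (s m), ∏ m, f m (i m) := by
    rw [Finset.prod_univ_sum, Fintype.piFinset_univ]
  have e1 : ∏ m, ∑ x, f m x = A n k z * A p l r *
        ∏ m ∈ (univ.erase n).erase p, ∑ i : Fin (s m), A m i r * A m i z := by
    rw [split, fn, fp, Finset.prod_congr rfl (fun m hm => by rw [fm m hm])]
    simp [mul_assoc]
  rw [← e1, key]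
  refine Finset.sum_congr rfl fun i _ => ?_
  rw [split, fn, fp, Finset.prod_congr rfl (fun m hm => by rw [fm m hm]), hJ, hJ,
    Finset.prod_mul_distrib,
    ← Finset.mul_prod_erase (univ.erase n) (fun m => A m (i m) r) (a := p) (by simp [hnp.symm]),
    ← Finset.mul_prod_erase (univ.erase p) (fun m => A m (i m) z) (a := n) (by simp [hnp]),
    Finset.erase_right_comm (a := p) (b := n)]
  ring
end

section
/- The 2×2 matrix multiplication tensor admits an exact CP decomposition of rank 7 (Strassen's algorithm): there exist vectors u_1,…,u_7, v_1,…,v_7, w_1,…,w_7, each indexed by (Fin 2 × Fin 2), such that for all indices, T_{(i,j),(k,l),(m,p)} = Σ_{r=1}^{7} u_{r,(i,j)} v_{r,(k,l)} w_{r,(m,p)}, where T_{(i,j),(k,l),(m,p)} = δ_{lm} δ_{ik} δ_{pj}. (With s = 4 denoting the dimension of each mode, 7 = s^{log₄ 7} < s^{3/2} = 8.) -/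
open Finset

/-- Strassen's algorithm: the `2×2` matrix multiplication tensor admits an exact rank-`7`
CP decomposition (with `s = 4` the mode dimension, `7 = s^{log₄ 7} < s^{3/2} = 8`). -/
theorem stmt_13 :
    ∃ u v w : Fin 7 → (Fin 2 × Fin 2) → ℝ,
      ∀ ij kl mp : Fin 2 × Fin 2,
        ((if kl.2 = mp.1 then 1 else 0) * (if ij.1 = kl.1 then 1 else 0) *
            (if mp.2 = ij.2 then 1 else 0) : ℝ) =
          ∑ r : Fin 7, u r ij * v r kl * w r mp := by
  refine ⟨fun r p => (![!![1,0;0,1], !![0,0;1,-1], !![0,1;0,1], !![1,0;1,0], !![-1,1;0,0],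
      !![0,0;0,1], !![1,0;0,0]] : Fin 7 → Matrix (Fin 2) (Fin 2) ℝ) r p.1 p.2,
    fun r p => (![!![1,0;0,1], !![0,0;1,1], !![1,0;0,0], !![0,0;0,1], !![1,1;0,0],
      !![-1,0;1,0], !![0,1;0,-1]] : Fin 7 → Matrix (Fin 2) (Fin 2) ℝ) r p.1 p.2,
    fun r p => (![!![1,0;0,1], !![1,0;0,0], !![0,1;0,-1], !![-1,0;1,0], !![0,0;0,1],
      !![1,1;0,0], !![0,0;1,1]] : Fin 7 → Matrix (Fin 2) (Fin 2) ℝ) r p.1 p.2, ?_⟩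
  rintro ⟨i, j⟩ ⟨k, l⟩ ⟨m, p⟩
  fin_cases i <;> fin_cases j <;> fin_cases k <;> fin_cases l <;> fin_cases m <;>
    fin_cases p <;> simp [Fin.sum_univ_succ]
end

section
/- Multiplication of each mode by a full-column-rank matrix preserves exact CP decompositions in both directions (Tucker compression preserves CP rank): let G ∈ ℝ^{R_1×⋯×R_N} be an order-N tensor, let U^{(m)} ∈ ℝ^{s_m×R_m} for m = 1,…,N each have full column rank (i.e., be injective as linear maps), and let X = G ×_1 U^{(1)} ×_2 ⋯ ×_N U^{(N)}, so that x_{i_1…i_N} = Σ_{j_1,…,j_N} g_{j_1…j_N} ∏_{m=1}^N u^{(m)}_{i_m j_m}. Then for every R ≥ 1, X admits an exact rank-R CP decomposition if and only if G does; hence the CP ranks of X and G are equal. -/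
open Finset

/-- `X` admits an exact rank-`R` CP decomposition. -/
def hasCPDecomp {N : ℕ} (s : Fin N → ℕ) (R : ℕ)
    (X : ((m : Fin N) → Fin (s m)) → ℝ) : Prop :=
  ∃ A : (m : Fin N) → Fin (s m) → Fin R → ℝ,
    ∀ i : (m : Fin N) → Fin (s m), X i = ∑ r : Fin R, ∏ m, A m (i m) r

theorem cp_push {N : ℕ} {d s : Fin N → ℕ} {R : ℕ}
    (G : ((m : Fin N) → Fin (d m)) → ℝ)
    (U : (m : Fin N) → Fin (s m) → Fin (d m) → ℝ)
    (X : ((m : Fin N) → Fin (s m)) → ℝ)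
    (hX : ∀ i : (m : Fin N) → Fin (s m),
      X i = ∑ j : (m : Fin N) → Fin (d m), G j * ∏ m, U m (i m) (j m))
    (h : hasCPDecomp d R G) : hasCPDecomp s R X := by
  obtain ⟨A, hA⟩ := h
  refine ⟨fun m i r => ∑ j, A m j r * U m i j, fun i => ?_⟩
  rw [hX]
  simp_rw [hA, Finset.sum_mul, ← Finset.prod_mul_distrib]
  rw [Finset.sum_comm]
  refine Finset.sum_congr rfl fun r _ => ?_
  rw [Finset.prod_univ_sum, Fintype.piFinset_univ]

theorem left_inv_exists {a b : ℕ} (U : Fin a → Fin b → ℝ)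
    (hU : Function.Injective
      (fun x : Fin b → ℝ => fun i : Fin a => ∑ j : Fin b, U i j * x j)) :
    ∃ V : Fin b → Fin a → ℝ, ∀ k j, ∑ i, V k i * U i j = if k = j then 1 else 0 := by
  have h1 : LinearMap.ker (Matrix.toLin' (Matrix.of U)) = ⊥ :=
    LinearMap.ker_eq_bot.2 hU
  obtain ⟨g, hg⟩ := LinearMap.exists_leftInverse_of_injective _ h1
  refine ⟨LinearMap.toMatrix' g, fun k j => ?_⟩
  have h2 := congrArg LinearMap.toMatrix' hg
  rw [LinearMap.toMatrix'_comp, LinearMap.toMatrix'_toLin', LinearMap.toMatrix'_id] at h2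
  have h3 := congrFun (congrFun h2 k) j
  rw [Matrix.mul_apply, Matrix.one_apply] at h3
  exact h3

theorem pull_eq {N : ℕ} {d s : Fin N → ℕ}
    (G : ((m : Fin N) → Fin (d m)) → ℝ)
    (U : (m : Fin N) → Fin (s m) → Fin (d m) → ℝ)
    (V : (m : Fin N) → Fin (d m) → Fin (s m) → ℝ)
    (hV : ∀ m k j, ∑ i, V m k i * U m i j = if k = j then 1 else 0)
    (X : ((m : Fin N) → Fin (s m)) → ℝ)
    (hX : ∀ i : (m : Fin N) → Fin (s m),
      X i = ∑ j : (m : Fin N) → Fin (d m), G j * ∏ m, U m (i m) (j m))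
    (k : (m : Fin N) → Fin (d m)) :
    G k = ∑ i : (m : Fin N) → Fin (s m), X i * ∏ m, V m (k m) (i m) := by
  simp_rw [hX, Finset.sum_mul]
  rw [Finset.sum_comm]
  have key : ∀ j : (m : Fin N) → Fin (d m),
      ∑ i : (m : Fin N) → Fin (s m), G j * (∏ m, U m (i m) (j m)) * ∏ m, V m (k m) (i m)
        = if k = j then G j else 0 := by
    intro j
    have h1 : ∏ m, ∑ i, V m (k m) i * U m i (j m) = if k = j then 1 else 0 := by
      simp_rw [hV]
      split_ifs with h
      · subst h; simp
      · obtain ⟨m, hm⟩ := Function.ne_iff.1 h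
        exact Finset.prod_eq_zero (Finset.mem_univ m) (if_neg hm)
    rw [Finset.prod_univ_sum, Fintype.piFinset_univ] at h1
    simp_rw [mul_assoc, ← Finset.prod_mul_distrib, mul_comm (U _ _ _)]
    rw [← Finset.mul_sum, h1]
    simp
  simp_rw [key]
  simp

/-- Tucker compression preserves CP rank: if `X = G ×₁ U^{(1)} ×₂ ⋯ ×_N U^{(N)}` where each
`U^{(m)}` has full column rank (is injective as a linear map), then for every `R ≥ 1`, `X`
admits an exact rank-`R` CP decomposition iff `G` does; hence their CP ranks coincide. -/
theorem stmt_15 {N : ℕ} (d s : Fin N → ℕ)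
    (G : ((m : Fin N) → Fin (d m)) → ℝ)
    (U : (m : Fin N) → Fin (s m) → Fin (d m) → ℝ)
    (hU : ∀ m : Fin N, Function.Injective
      (fun x : Fin (d m) → ℝ => fun i : Fin (s m) => ∑ j : Fin (d m), U m i j * x j))
    (X : ((m : Fin N) → Fin (s m)) → ℝ)
    (hX : ∀ i : (m : Fin N) → Fin (s m),
      X i = ∑ j : (m : Fin N) → Fin (d m), G j * ∏ m, U m (i m) (j m)) :
    (∀ R : ℕ, 1 ≤ R → (hasCPDecomp s R X ↔ hasCPDecomp d R G)) ∧
    sInf {R : ℕ | hasCPDecomp s R X} = sInf {R : ℕ | hasCPDecomp d R G} := by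
  have hI : ∀ R : ℕ, hasCPDecomp s R X ↔ hasCPDecomp d R G := by
    intro R
    choose V hV using fun m => left_inv_exists (U m) (hU m)
    exact ⟨cp_push X V G (pull_eq G U V hV X hX), cp_push G U X hX⟩
  exact ⟨fun R _ => hI R, by simp_rw [hI]⟩
end
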